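/- Let α be irrational such that a_n ≥ 2 for infinitely many n and such that Σ_{n ≥ 2, a_n ≥ 2 and a_{n+1} ≥ 2} 1/log(q_n) = ∞. Then for Haar-almost every x ∈ T one has limsup_{j→∞} (1/‖x + jα‖) / (Σ_{i=0}^{j−1} 1/‖x + iα‖) = +∞; in particular, for almost every x and every M > 0 there exists j with 1/‖x + jα‖ > M · Σ_{i=0}^{j−1} 1/‖x + iα‖. -/

import Mathlib

/-- The complete quotients of the continued fraction expansion of `α`
(`cfQuot α 0 = α`, and `cfQuot α (n+1)` is the inverse of the fractional part
of `cfQuot α n`). -/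
noncomputable def cfQuot (α : ℝ) : ℕ → ℝ
  | 0 => α
  | n + 1 => (cfQuot α n - ⌊cfQuot α n⌋)⁻¹

/-- The partial quotients `aₙ` of the continued fraction expansion
`α = [a₀; a₁, a₂, …]` (as natural numbers; for irrational `α` and `n ≥ 1`
one has `cfa α n ≥ 1`). -/
noncomputable def cfa (α : ℝ) (n : ℕ) : ℕ := (⌊cfQuot α n⌋).toNat

/-- The denominators `qₙ` of the convergents `pₙ/qₙ` of `α`:
`q₀ = 1`, `q₁ = a₁` and `q_{n+2} = a_{n+2} q_{n+1} + q_n`. -/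
noncomputable def cfq (α : ℝ) : ℕ → ℕ
  | 0 => 1
  | 1 => cfa α 1
  | n + 2 => cfa α (n + 2) * cfq α (n + 1) + cfq α n

/-- The numerators `pₙ` of the convergents `pₙ/qₙ` of `α`:
`p₀ = a₀`, `p₁ = a₁ a₀ + 1` and `p_{n+2} = a_{n+2} p_{n+1} + pₙ`. -/
noncomputable def cfp (α : ℝ) : ℕ → ℤ
  | 0 => ⌊α⌋
  | 1 => (cfa α 1 : ℤ) * ⌊α⌋ + 1
  | n + 2 => (cfa α (n + 2) : ℤ) * cfp α (n + 1) + cfp α n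

/-- `ρₙ = qₙ α − pₙ`. -/
noncomputable def cfrho (α : ℝ) (n : ℕ) : ℝ := (cfq α n : ℝ) * α - (cfp α n : ℝ)

/-- `λ⁽ⁿ⁾ = |ρₙ| = ‖qₙ α‖`, the distance from `qₙ α` to the nearest integer. -/
noncomputable def cflam (α : ℝ) (n : ℕ) : ℝ := |cfrho α n|

open Filter

open MeasureTheory

theorem irrational_cfQuot {α : ℝ} (hα : Irrational α) (n : ℕ) : Irrational (cfQuot α n) := by
  induction n with
  | zero => exact hα
  | succ n ih => exact (ih.sub_intCast ⌊cfQuot α n⌋).inv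

theorem one_lt_cfQuot_succ {α : ℝ} (hα : Irrational α) (n : ℕ) : 1 < cfQuot α (n + 1) := by
  have hirr := irrational_cfQuot hα n
  have hpos : 0 < Int.fract (cfQuot α n) :=
    Int.fract_pos.2 fun h => hirr ⟨(⌊cfQuot α n⌋ : ℚ), by simpa using h.symm⟩
  exact (one_lt_inv₀ hpos).2 (Int.fract_lt_one _)

theorem cfa_succ_cast {α : ℝ} (hα : Irrational α) (n : ℕ) :
    (cfa α (n + 1) : ℝ) = ⌊cfQuot α (n + 1)⌋ := by
  have h : 0 ≤ ⌊cfQuot α (n + 1)⌋ :=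
    Int.floor_nonneg.2 (zero_le_one.trans (one_lt_cfQuot_succ hα n).le)
  exact_mod_cast Int.toNat_of_nonneg h

theorem one_le_cfa_succ {α : ℝ} (hα : Irrational α) (n : ℕ) : 1 ≤ cfa α (n + 1) := by
  have h : (1 : ℤ) ≤ ⌊cfQuot α (n + 1)⌋ :=
    Int.le_floor.2 (by simpa using (one_lt_cfQuot_succ hα n).le)
  unfold cfa
  omega

theorem cfQuot_sub_cfa {α : ℝ} (hα : Irrational α) (n : ℕ) :
    cfQuot α (n + 1) - cfa α (n + 1) = (cfQuot α (n + 2))⁻¹ := by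
  rw [cfa_succ_cast hα]
  simp [cfQuot]

theorem cfq_pos {α : ℝ} (hα : Irrational α) : ∀ n, 0 < cfq α n
  | 0 => one_pos
  | 1 => one_le_cfa_succ hα 0
  | n + 2 => Nat.add_pos_right _ (cfq_pos hα n)

theorem cfq_add_le {α : ℝ} (hα : Irrational α) (n : ℕ) :
    cfq α (n + 1) + cfq α n ≤ cfq α (n + 2) :=
  Nat.add_le_add_right (Nat.le_mul_of_pos_left _ (one_le_cfa_succ hα (n + 1))) _

theorem cfq_mono {α : ℝ} (hα : Irrational α) : Monotone (cfq α) := by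
  refine monotone_nat_of_le_succ fun n => ?_
  cases n with
  | zero => exact one_le_cfa_succ hα 0
  | succ n => exact le_of_add_le_left (cfq_add_le hα n)

theorem le_cfq {α : ℝ} (hα : Irrational α) : ∀ n, n ≤ cfq α n
  | 0 => Nat.zero_le _
  | 1 => one_le_cfa_succ hα 0
  | n + 2 => (Nat.add_le_add (le_cfq hα (n + 1)) (cfq_pos hα n)).trans (cfq_add_le hα n)

theorem two_mul_cfq_le {α : ℝ} {n : ℕ} (h : 2 ≤ cfa α (n + 1)) :
    2 * cfq α n ≤ cfq α (n + 1) := by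
  cases n with
  | zero => simpa [cfq] using h
  | succ n => exact (Nat.mul_le_mul_right _ h).trans (Nat.le_add_right _ _)

theorem three_le_cfq {α : ℝ} (hα : Irrational α) {n : ℕ} (hn : 2 ≤ n) (h : 2 ≤ cfa α n) :
    3 ≤ cfq α n := by
  obtain ⟨n, rfl⟩ := Nat.exists_eq_add_of_le' hn
  have h₁ := cfq_pos hα (n + 1)
  have h₀ := cfq_pos hα n
  change 3 ≤ cfa α (n + 2) * cfq α (n + 1) + cfq α n
  nlinarith

theorem sum_cfq_le {α : ℝ} (hα : Irrational α) (n : ℕ) :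
    ∑ m ∈ Finset.range (n + 2), cfq α m ≤ 2 * cfq α (n + 1) + cfq α n := by
  induction n with
  | zero => simp [Finset.sum_range_succ, cfq]; omega
  | succ n ih =>
    rw [Finset.sum_range_succ]
    change _ + cfq α (n + 2) ≤ 2 * cfq α (n + 2) + cfq α (n + 1)
    have := cfq_add_le hα n
    omega

theorem sum_range_succ_cfq_le {α : ℝ} (hα : Irrational α) (n : ℕ) :
    ∑ m ∈ Finset.range (n + 1), cfq α m ≤ 3 * cfq α n := by
  cases n with
  | zero => simp; omega
  | succ n =>
    have : cfq α n ≤ cfq α (n + 1) := cfq_mono hα n.le_succ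
    have : ∑ m ∈ Finset.range (n + 1 + 1), cfq α m ≤ 2 * cfq α (n + 1) + cfq α n :=
      sum_cfq_le hα n
    omega

theorem abs_cfp_mul_cfq_sub {α : ℝ} (n : ℕ) :
    |cfp α (n + 1) * cfq α n - cfp α n * cfq α (n + 1)| = 1 := by
  induction n with
  | zero => simp [cfp, cfq]; ring_nf; simp
  | succ n ih =>
    rw [← ih, ← abs_neg]
    simp only [cfp, cfq]
    push_cast
    ring_nf

theorem isCoprime_cfp_cfq {α : ℝ} (n : ℕ) : IsCoprime (cfp α n) (cfq α n : ℤ) := by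
  rcases eq_or_eq_neg_of_abs_eq (abs_cfp_mul_cfq_sub (α := α) n) with h | h
  · exact ⟨-cfq α (n + 1), cfp α (n + 1), by linear_combination h⟩
  · exact ⟨cfq α (n + 1), -cfp α (n + 1), by linear_combination -h⟩

theorem cfrho_add_two {α : ℝ} (n : ℕ) :
    cfrho α (n + 2) = cfa α (n + 2) * cfrho α (n + 1) + cfrho α n := by
  simp only [cfrho, cfq, cfp]
  push_cast
  ring

theorem cfQuot_mul_cfrho {α : ℝ} (hα : Irrational α) (n : ℕ) :
    cfQuot α (n + 2) * cfrho α (n + 1) + cfrho α n = 0 := by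
  induction n with
  | zero =>
    have h₂ : cfQuot α 2 ≠ 0 := (irrational_cfQuot hα 2).ne_zero
    have h₁ : cfQuot α 1 ≠ 0 := (irrational_cfQuot hα 1).ne_zero
    have ha : (cfa α 1 : ℝ) = cfQuot α 1 - (cfQuot α 2)⁻¹ := by
      rw [← cfQuot_sub_cfa hα 0]; ring
    have h₀ : α - ⌊α⌋ = (cfQuot α 1)⁻¹ := by simp [cfQuot]
    have hr : cfrho α 1 = cfa α 1 * (α - ⌊α⌋) - 1 := by
      simp only [cfrho, cfq, cfp]; push_cast; ring
    have hr₀ : cfrho α 0 = α - ⌊α⌋ := by simp [cfrho, cfq, cfp]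
    rw [hr, hr₀, h₀, ha]
    field_simp
    ring
  | succ n ih =>
    have h₃ : cfQuot α (n + 3) ≠ 0 := (irrational_cfQuot hα _).ne_zero
    have ha : (cfa α (n + 2) : ℝ) = cfQuot α (n + 2) - (cfQuot α (n + 3))⁻¹ := by
      rw [← cfQuot_sub_cfa hα (n + 1)]; ring
    rw [show n + 1 + 2 = n + 3 from rfl, show n + 1 + 1 = n + 2 from rfl, cfrho_add_two, ha]
    field_simp
    linear_combination cfQuot α (n + 3) * ih

theorem cfq_mul_abs_cfrho_le {α : ℝ} (hα : Irrational α) (n : ℕ) :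
    cfq α (n + 1) * |cfrho α n| ≤ 1 := by
  have hx : 0 < cfQuot α (n + 2) := zero_lt_one.trans (one_lt_cfQuot_succ hα (n + 1))
  have hq : (0 : ℝ) ≤ cfq α n := Nat.cast_nonneg _
  have hρ : cfrho α n = -(cfQuot α (n + 2) * cfrho α (n + 1)) :=
    eq_neg_of_add_eq_zero_right (cfQuot_mul_cfrho hα n)
  have hdet : |(cfq α (n + 1) : ℝ) * cfrho α n - cfq α n * cfrho α (n + 1)| = 1 := by
    have h : |((cfp α (n + 1) : ℝ) * cfq α n - cfp α n * cfq α (n + 1))| = 1 := by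
      exact_mod_cast abs_cfp_mul_cfq_sub (α := α) n
    rw [← h]
    simp only [cfrho]
    ring_nf
  have hfac : (cfq α (n + 1) : ℝ) * cfrho α n - cfq α n * cfrho α (n + 1) =
      -((cfq α (n + 1) * cfQuot α (n + 2) + cfq α n) * cfrho α (n + 1)) := by
    rw [hρ]; ring
  rw [hfac, abs_neg, abs_mul, abs_of_nonneg (by positivity)] at hdet
  rw [hρ, abs_neg, abs_mul, abs_of_pos hx]
  nlinarith [abs_nonneg (cfrho α (n + 1))]

/-- If `a_{n+1} ≥ 2`, the multiples `kα` with `0 < k < qₙ` stay at distance at least `1 / (2 qₙ)`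
from the integers. -/
theorem inv_two_cfq_le_norm {α : ℝ} (hα : Irrational α) {n : ℕ} (h : 2 ≤ cfa α (n + 1)) {k : ℕ}
    (hk : 0 < k) (hkq : k < cfq α n) :
    (2 * cfq α n : ℝ)⁻¹ ≤ ‖k • (α : UnitAddCircle)‖ := by
  rw [← AddCircle.coe_nsmul, UnitAddCircle.norm_eq, nsmul_eq_mul]
  generalize round ((k : ℝ) * α) = p
  have hq : (0 : ℝ) < cfq α n := by exact_mod_cast cfq_pos hα n
  have hne : (k : ℤ) * cfp α n - p * cfq α n ≠ 0 := by
    intro h0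
    have hdvd : (cfq α n : ℤ) ∣ cfp α n * k := ⟨p, by linear_combination h0⟩
    have := (isCoprime_cfp_cfq n).symm.dvd_of_dvd_mul_left hdvd
    exact absurd (Nat.le_of_dvd hk (by exact_mod_cast this)) hkq.not_ge
  have hone : (1 : ℝ) ≤ |(k : ℝ) * cfp α n - p * cfq α n| := by
    exact_mod_cast Int.one_le_abs hne
  have hid : (k : ℝ) * cfp α n - p * cfq α n = cfq α n * (k * α - p) - k * cfrho α n := by
    simp only [cfrho]; ring
  have htri : |(k : ℝ) * cfp α n - p * cfq α n| ≤
      cfq α n * |k * α - p| + k * |cfrho α n| := by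
    rw [hid]
    refine (abs_sub _ _).trans ?_
    rw [abs_mul, abs_mul, Nat.abs_cast, Nat.abs_cast]
  have hrho := cfq_mul_abs_cfrho_le hα n
  have h2 : (2 : ℝ) * cfq α n ≤ cfq α (n + 1) := by exact_mod_cast two_mul_cfq_le h
  have hk' : (k : ℝ) ≤ cfq α n := by exact_mod_cast hkq.le
  rw [inv_le_iff_one_le_mul₀ (by positivity)]
  nlinarith [abs_nonneg (cfrho α n)]

/-- Points of the circle that are `1 / (2q)`-separated along an orbit are indexed injectively by
integers comparable with `2q` times their signed distance to `0`. -/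
theorem exists_injOn_floor {a : UnitAddCircle} {q : ℕ}
    (hsep : ∀ k, 0 < k → k < q → (2 * q : ℝ)⁻¹ ≤ ‖k • a‖) (y : UnitAddCircle) :
    ∃ κ : ℕ → ℤ, Set.InjOn κ (Finset.range q) ∧
      ∀ j, ∃ z : ℝ, |z| = ‖y + j • a‖ ∧ κ j = ⌊2 * q * z⌋ := by
  have hrep : ∀ u : UnitAddCircle, ∃ z : ℝ, (z : UnitAddCircle) = u ∧ |z| = ‖u‖ := by
    intro u
    obtain ⟨x, rfl⟩ := QuotientAddGroup.mk_surjective u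
    refine ⟨x - round x, ?_, UnitAddCircle.norm_eq.symm⟩
    have : ((round x : ℝ) : UnitAddCircle) = 0 := by
      have := AddCircle.coe_eq_zero_iff (1 : ℝ) (x := (round x : ℝ))
      exact this.2 ⟨round x, by simp⟩
    rw [AddCircle.coe_sub, this, sub_zero]
  choose z hz hzn using fun j : ℕ => hrep (y + j • a)
  refine ⟨fun j => ⌊2 * q * z j⌋, ?_, fun j => ⟨z j, hzn j, rfl⟩⟩
  have key : ∀ i j, i < j → j < q → ⌊2 * q * z i⌋ ≠ ⌊2 * q * z j⌋ := by
    intro i j hij hj heq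
    have hq : (0 : ℝ) < q := by exact_mod_cast (Nat.zero_le _).trans_lt hj
    have h1 := Int.abs_sub_lt_one_of_floor_eq_floor heq
    have h2 := hsep (j - i) (by omega) (by omega)
    have h3 : ((z i - z j : ℝ) : UnitAddCircle) = -((j - i) • a) := by
      rw [AddCircle.coe_sub, hz, hz, sub_nsmul _ hij.le]
      abel
    have h4 : ‖(j - i) • a‖ ≤ |z i - z j| := by
      rw [← norm_neg, ← h3]
      exact QuotientAddGroup.norm_mk_le_norm
    rw [← mul_sub, abs_mul, abs_of_pos (by positivity)] at h1
    rw [inv_le_iff_one_le_mul₀ (by positivity)] at h2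
    nlinarith
  intro i hi j hj heq
  rw [Finset.coe_range, Set.mem_Iio] at hi hj
  rcases lt_trichotomy i j with h | h | h
  · exact absurd heq (key i j h hj)
  · exact h
  · exact absurd heq.symm (key j i h hi)

theorem card_filter_norm_le {a : UnitAddCircle} {q : ℕ}
    (hsep : ∀ k, 0 < k → k < q → (2 * q : ℝ)⁻¹ ≤ ‖k • a‖) (y : UnitAddCircle) {R : ℝ}
    (hR : 0 ≤ R) :
    (((Finset.range q).filter fun j => ‖y + j • a‖ ≤ R).card : ℝ) ≤ 4 * q * R + 2 := by
  obtain ⟨κ, hinj, hκ⟩ := exists_injOn_floor hsep y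
  have hsub : ((Finset.range q).filter fun j => ‖y + j • a‖ ≤ R).card ≤
      (Finset.Icc ⌊-(2 * q * R)⌋ ⌊2 * q * R⌋).card := by
    refine Finset.card_le_card_of_injOn κ ?_ (hinj.mono ?_)
    · intro j hj
      obtain ⟨z, hz, hκz⟩ := hκ j
      have hzR : |z| ≤ R := hz.trans_le (Finset.mem_filter.1 hj).2
      rw [abs_le] at hzR
      have hq : (0 : ℝ) ≤ q := Nat.cast_nonneg _
      simp only [Finset.coe_Icc, Set.mem_Icc, hκz]
      constructor <;> apply Int.floor_le_floor <;> nlinarith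
    · exact_mod_cast Finset.filter_subset _ _
  have hmono : ⌊-(2 * q * R)⌋ ≤ ⌊2 * q * R⌋ := by
    apply Int.floor_le_floor
    have : 0 ≤ 2 * q * R := by positivity
    linarith
  have hcard : ((Finset.Icc ⌊-(2 * q * R)⌋ ⌊2 * q * R⌋).card : ℝ) =
      ⌊2 * q * R⌋ + 1 - ⌊-(2 * q * R)⌋ := by
    have := Int.card_Icc_of_le ⌊-(2 * q * R)⌋ ⌊2 * q * R⌋ (by omega)
    exact_mod_cast this
  have h1 := Int.floor_le (2 * q * R)
  have h2 := Int.lt_floor_add_one (-(2 * q * R))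
  have h3 : (((Finset.range q).filter fun j => ‖y + j • a‖ ≤ R).card : ℝ) ≤
    ((Finset.Icc ⌊-(2 * q * R)⌋ ⌊2 * q * R⌋).card : ℝ) := by exact_mod_cast hsub
  linarith

theorem sum_Icc_inv_max_abs (n : ℕ) :
    ∑ k ∈ Finset.Icc (-n : ℤ) n, (max 1 |(k : ℝ)|)⁻¹ = 1 + 2 * (harmonic n : ℝ) := by
  induction n with
  | zero => simp
  | succ n ih =>
    have hset : Finset.Icc (-((n + 1 : ℕ) : ℤ)) ((n + 1 : ℕ) : ℤ) =
        insert (-((n + 1 : ℕ) : ℤ)) (insert ((n + 1 : ℕ) : ℤ) (Finset.Icc (-n : ℤ) n)) := by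
      ext k
      simp only [Finset.mem_Icc, Finset.mem_insert]
      omega
    rw [hset, Finset.sum_insert, Finset.sum_insert, ih, harmonic_succ]
    · have h1 : max 1 |((-((n + 1 : ℕ) : ℤ) : ℤ) : ℝ)| = n + 1 := by
        push_cast
        rw [abs_neg, abs_of_nonneg (by positivity)]
        simp
      have h2 : max 1 |(((n + 1 : ℕ) : ℤ) : ℝ)| = n + 1 := by
        push_cast
        rw [abs_of_nonneg (by positivity)]
        simp
      rw [h1, h2]
      push_cast
      ring
    · simp
    · simp only [Finset.mem_insert, Finset.mem_Icc]
      omega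

theorem sum_inv_norm_le {a : UnitAddCircle} {q : ℕ} (hq : 3 ≤ q)
    (hsep : ∀ k, 0 < k → k < q → (2 * q : ℝ)⁻¹ ≤ ‖k • a‖) {y : UnitAddCircle} {j : ℕ} (hj : j < q)
    (hy : ‖y + j • a‖ ≤ (4 * q : ℝ)⁻¹) :
    ∑ i ∈ Finset.range j, ‖y + i • a‖⁻¹ ≤ 30 * (q * Real.log q) := by
  obtain ⟨κ, hinj, hκ⟩ := exists_injOn_floor hsep y
  have hq0 : (0 : ℝ) < q := by positivity
  have hbound : ∀ i ∈ Finset.range j, κ i ∈ Finset.Icc (-q : ℤ) q ∧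
      ‖y + i • a‖⁻¹ ≤ 6 * q * (max 1 |(κ i : ℝ)|)⁻¹ := by
    intro i hi
    rw [Finset.mem_range] at hi
    obtain ⟨z, hz, hκz⟩ := hκ i
    have hlow : (4 * q : ℝ)⁻¹ ≤ |z| := by
      have h1 := hsep (j - i) (by omega) (by omega)
      have h2 : (j - i) • a = (y + j • a) - (y + i • a) := by
        rw [sub_nsmul _ hi.le]; abel
      have h3 : ‖(j - i) • a‖ ≤ ‖y + j • a‖ + ‖y + i • a‖ := by
        rw [h2]; exact norm_sub_le _ _
      have h4 : (2 * q : ℝ)⁻¹ = (4 * q : ℝ)⁻¹ + (4 * q : ℝ)⁻¹ := by field_simp; norm_num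
      linarith
    have hhalf : |z| ≤ 1 / 2 := by
      rw [hz]; simpa using AddCircle.norm_le_half_period (1 : ℝ) one_ne_zero (x := y + i • a)
    have hzpos : 0 < |z| := lt_of_lt_of_le (by positivity) hlow
    have hlow' : 1 ≤ 4 * q * |z| := by
      rwa [inv_le_iff_one_le_mul₀' (by positivity)] at hlow
    have hf1 := Int.floor_le (2 * q * z)
    have hf2 := Int.lt_floor_add_one (2 * q * z)
    rw [← hκz] at hf1 hf2
    obtain ⟨hh1, hh2⟩ := abs_le.1 hhalf
    refine ⟨?_, ?_⟩
    · rw [Finset.mem_Icc, hκz]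
      constructor
      · apply Int.le_floor.2; push_cast; nlinarith
      · apply Int.floor_le_iff.2; push_cast; nlinarith
    · rw [← hz, ← div_eq_mul_inv, le_div_iff₀ (by positivity), inv_mul_le_iff₀ hzpos]
      refine max_le (by nlinarith) (abs_le.2 ⟨?_, ?_⟩)
      · nlinarith [neg_abs_le z]
      · nlinarith [le_abs_self z]
  have hlog : 1 ≤ Real.log q := by
    rw [Real.le_log_iff_exp_le hq0]
    exact Real.exp_one_lt_three.le.trans (by exact_mod_cast hq)
  calc ∑ i ∈ Finset.range j, ‖y + i • a‖⁻¹
      ≤ ∑ i ∈ Finset.range j, 6 * q * (max 1 |(κ i : ℝ)|)⁻¹ :=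
        Finset.sum_le_sum fun i hi => (hbound i hi).2
    _ = ∑ k ∈ (Finset.range j).image κ, 6 * q * (max 1 |(k : ℝ)|)⁻¹ := by
        rw [Finset.sum_image]
        exact hinj.mono (by simpa using hj.le)
    _ ≤ ∑ k ∈ Finset.Icc (-q : ℤ) q, 6 * q * (max 1 |(k : ℝ)|)⁻¹ := by
        refine Finset.sum_le_sum_of_subset_of_nonneg ?_ fun _ _ _ => by positivity
        exact Finset.image_subset_iff.2 fun i hi => (hbound i hi).1
    _ = 6 * q * (1 + 2 * (harmonic q : ℝ)) := by
        rw [← Finset.mul_sum, sum_Icc_inv_max_abs]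
    _ ≤ 6 * q * (5 * Real.log q) := by
        have := harmonic_le_one_add_log q
        gcongr
        linarith
    _ = 30 * (q * Real.log q) := by ring

/-- The second-moment (Kochen–Stone) lower bound for the measure of a finite union. -/
theorem sq_sum_measureReal_le {Ω ι : Type*} [MeasurableSpace Ω] {μ : Measure Ω} [IsFiniteMeasure μ]
    (s : Finset ι) {A : ι → Set Ω} (hA : ∀ i, MeasurableSet (A i)) :
    (∑ i ∈ s, μ.real (A i)) ^ 2 ≤
      μ.real (⋃ i ∈ s, A i) * ∑ i ∈ s, ∑ j ∈ s, μ.real (A i ∩ A j) := by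
  set U := ⋃ i ∈ s, A i with hU
  have hUm : MeasurableSet U := Finset.measurableSet_biUnion s fun i _ => hA i
  have hind : ∀ B : Set Ω, MeasurableSet B → Integrable (B.indicator (1 : Ω → ℝ)) μ := fun B hB =>
    (integrable_const (1 : ℝ)).indicator hB
  have hreal : ∀ B : Set Ω, MeasurableSet B → ∫ x, B.indicator (1 : Ω → ℝ) x ∂μ = μ.real B :=
    fun B hB => integral_indicator_one hB
  have key : ∀ t : ℝ, 0 ≤ μ.real U * (t * t) + (-2 * ∑ i ∈ s, μ.real (A i)) * t +
      ∑ i ∈ s, ∑ j ∈ s, μ.real (A i ∩ A j) := by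
    intro t
    have hexp : ∀ x, (∑ i ∈ s, (A i).indicator (1 : Ω → ℝ) x - t * U.indicator (1 : Ω → ℝ) x) ^ 2 =
        (∑ i ∈ s, ∑ j ∈ s, (A i ∩ A j).indicator (1 : Ω → ℝ) x
          - 2 * t * ∑ i ∈ s, (A i).indicator (1 : Ω → ℝ) x)
          + t * t * U.indicator (1 : Ω → ℝ) x := by
      intro x
      have h1 : ∑ i ∈ s, ∑ j ∈ s, (A i ∩ A j).indicator (1 : Ω → ℝ) x =
          (∑ i ∈ s, (A i).indicator (1 : Ω → ℝ) x) * ∑ i ∈ s, (A i).indicator (1 : Ω → ℝ) x := by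
        rw [Finset.sum_mul_sum]
        refine Finset.sum_congr rfl fun i _ => Finset.sum_congr rfl fun j _ => ?_
        rw [Set.inter_indicator_one, Pi.mul_apply]
      rw [h1]
      by_cases hx : x ∈ U
      · rw [Set.indicator_of_mem hx, Pi.one_apply]
        ring
      · have h0 : ∑ i ∈ s, (A i).indicator (1 : Ω → ℝ) x = 0 :=
          Finset.sum_eq_zero fun i hi =>
            Set.indicator_of_notMem (fun h => hx (Set.mem_biUnion hi h)) _
        rw [h0, Set.indicator_of_notMem hx]
        ring
    have hnonneg : 0 ≤ ∫ x, (∑ i ∈ s, (A i).indicator (1 : Ω → ℝ) x -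
        t * U.indicator (1 : Ω → ℝ) x) ^ 2 ∂μ := integral_nonneg fun x => sq_nonneg _
    have hI1 : Integrable (fun x => ∑ i ∈ s, (A i).indicator (1 : Ω → ℝ) x) μ :=
      integrable_finsetSum s fun i _ => hind _ (hA i)
    have hI2' : ∀ i ∈ s,
        Integrable (fun x => ∑ j ∈ s, (A i ∩ A j).indicator (1 : Ω → ℝ) x) μ := fun i _ =>
      integrable_finsetSum s fun j _ => hind _ ((hA i).inter (hA j))
    have hI2 : Integrable (fun x => ∑ i ∈ s, ∑ j ∈ s, (A i ∩ A j).indicator (1 : Ω → ℝ) x) μ :=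
      integrable_finsetSum s hI2'
    have hI3 := (hind U hUm).const_mul (t * t)
    simp_rw [hexp] at hnonneg
    have hI4 : Integrable (fun x => ∑ i ∈ s, ∑ j ∈ s, (A i ∩ A j).indicator (1 : Ω → ℝ) x
        - 2 * t * ∑ i ∈ s, (A i).indicator (1 : Ω → ℝ) x) μ := hI2.sub (hI1.const_mul _)
    rw [integral_add hI4 hI3, integral_sub hI2 (hI1.const_mul _),
      integral_const_mul, integral_const_mul, integral_finsetSum s hI2',
      integral_finsetSum s fun i _ => hind _ (hA i), hreal U hUm] at hnonneg
    simp_rw [hreal _ (hA _)] at hnonneg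
    have hE : ∀ i ∈ s, ∫ x, ∑ j ∈ s, (A i ∩ A j).indicator (1 : Ω → ℝ) x ∂μ =
        ∑ j ∈ s, μ.real (A i ∩ A j) := by
      intro i _
      rw [integral_finsetSum s fun j _ => hind _ ((hA i).inter (hA j))]
      exact Finset.sum_congr rfl fun j _ => hreal _ ((hA i).inter (hA j))
    rw [Finset.sum_congr rfl hE] at hnonneg
    linarith
  have := discrim_le_zero key
  rw [discrim] at this
  linarith

theorem measureReal_closedBall (x : UnitAddCircle) {r : ℝ} (h0 : 0 ≤ r) (hr : 2 * r ≤ 1) :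
    (volume : Measure UnitAddCircle).real (Metric.closedBall x r) = 2 * r := by
  rw [Measure.real, AddCircle.volume_closedBall, min_eq_right hr, ENNReal.toReal_ofReal]
  positivity

theorem sum_sum_measureReal_inter_le {a : UnitAddCircle} {q q' : ℕ}
    (hsep : ∀ k, 0 < k → k < q → (2 * q : ℝ)⁻¹ ≤ ‖k • a‖) {r r' : ℝ} (h0 : 0 ≤ r) (hrr : r ≤ r')
    (hr : 2 * r ≤ 1) {I J : Finset ℕ} (hJ : J ⊆ Finset.range q) (hI : I ⊆ Finset.range q') :
    ∑ j ∈ J, ∑ i ∈ I, (volume : Measure UnitAddCircle).real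
      (Metric.closedBall (-(j • a)) r ∩ Metric.closedBall (-(i • a)) r') ≤
      2 * r * (q' * (8 * q * r' + 2)) := by
  have hterm : ∀ i j : ℕ, (volume : Measure UnitAddCircle).real
      (Metric.closedBall (-(j • a)) r ∩ Metric.closedBall (-(i • a)) r') ≤
      if ‖-(i • a) + j • a‖ ≤ 2 * r' then 2 * r else 0 := by
    intro i j
    split_ifs with h
    · rw [← measureReal_closedBall (-(j • a)) h0 hr]
      exact measureReal_mono Set.inter_subset_left
    · rw [Set.disjoint_iff_inter_eq_empty.1, measureReal_empty]
      refine Metric.closedBall_disjoint_closedBall ?_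
      rw [dist_eq_norm, show -(j • a) - -(i • a) = -(-(i • a) + j • a) by abel, norm_neg]
      linarith
  have hone : ∀ i : ℕ, ∑ j ∈ J, (volume : Measure UnitAddCircle).real
      (Metric.closedBall (-(j • a)) r ∩ Metric.closedBall (-(i • a)) r') ≤
      2 * r * (8 * q * r' + 2) := by
    intro i
    calc _ ≤ ∑ j ∈ Finset.range q, if ‖-(i • a) + j • a‖ ≤ 2 * r' then 2 * r else 0 :=
          (Finset.sum_le_sum fun j _ => hterm i j).trans
            (Finset.sum_le_sum_of_subset_of_nonneg hJ fun j _ _ => by positivity)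
      _ = ((Finset.range q).filter fun j => ‖-(i • a) + j • a‖ ≤ 2 * r').card * (2 * r) := by
          rw [← Finset.sum_filter, Finset.sum_const, nsmul_eq_mul]
      _ ≤ (4 * q * (2 * r') + 2) * (2 * r) := by
          gcongr
          exact card_filter_norm_le hsep _ (by linarith)
      _ = _ := by ring
  have hr' : 0 ≤ r' := h0.trans hrr
  rw [Finset.sum_comm]
  calc _ ≤ ∑ i ∈ I, 2 * r * (8 * q * r' + 2) := Finset.sum_le_sum fun i _ => hone i
    _ ≤ ∑ i ∈ Finset.range q', 2 * r * (8 * q * r' + 2) :=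
        Finset.sum_le_sum_of_subset_of_nonneg hI fun _ _ _ => by positivity
    _ = _ := by rw [Finset.sum_const, Finset.card_range, nsmul_eq_mul]; ring

/-- The indices `n ≥ 2` with `aₙ ≥ 2` and `a_{n+1} ≥ 2`. -/
def IsGoodIndex (α : ℝ) (n : ℕ) : Prop := 2 ≤ n ∧ 2 ≤ cfa α n ∧ 2 ≤ cfa α (n + 1)

namespace IsGoodIndex

variable {α : ℝ} {n : ℕ}

theorem one_le_log (hα : Irrational α) (h : IsGoodIndex α n) : 1 ≤ Real.log (cfq α n) := by
  have h3 := three_le_cfq hα h.1 h.2.1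
  have hq : (0 : ℝ) < cfq α n := by exact_mod_cast cfq_pos hα n
  rw [Real.le_log_iff_exp_le hq]
  exact Real.exp_one_lt_three.le.trans (by exact_mod_cast h3)

theorem two_mul_cfq_sub_one_le (h : IsGoodIndex α n) : 2 * cfq α (n - 1) ≤ cfq α n := by
  obtain ⟨m, rfl⟩ := Nat.exists_eq_add_of_le' (one_le_two.trans h.1)
  exact two_mul_cfq_le h.2.1

theorem separated (hα : Irrational α) (h : IsGoodIndex α n) :
    ∀ k, 0 < k → k < cfq α n → (2 * cfq α n : ℝ)⁻¹ ≤ ‖k • (α : UnitAddCircle)‖ :=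
  fun _ hk hkq => inv_two_cfq_le_norm hα h.2.2 hk hkq

end IsGoodIndex

/-- The ball of radius `ε / (qₙ log qₙ)` around `-jα`. -/
noncomputable def hitBall (α ε : ℝ) (n j : ℕ) : Set UnitAddCircle :=
  Metric.closedBall (-(j • (α : UnitAddCircle))) (ε / Real.log (cfq α n) / cfq α n)

theorem hitBall_radius_bounds {α ε : ℝ} (hα : Irrational α) (hε : 0 < ε) (hε4 : ε ≤ 1 / 4)
    {n : ℕ} (hn : IsGoodIndex α n) :
    0 < ε / Real.log (cfq α n) / cfq α n ∧
      ε / Real.log (cfq α n) / cfq α n ≤ (4 * cfq α n : ℝ)⁻¹ := by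
  have hl := hn.one_le_log hα
  have hq : (0 : ℝ) < cfq α n := by exact_mod_cast cfq_pos hα n
  refine ⟨by positivity, ?_⟩
  rw [mul_inv, div_eq_mul_inv _ (cfq α n : ℝ)]
  gcongr
  rw [div_le_iff₀ (by positivity)]
  linarith

theorem sum_sum_hitBall_inter_le {α ε : ℝ} (hα : Irrational α) (hε : 0 < ε) (hε4 : ε ≤ 1 / 4)
    {n m : ℕ} (hn : IsGoodIndex α n) (hm : IsGoodIndex α m) (hmn : m ≤ n) :
    ∑ j ∈ Finset.Ico (cfq α (n - 1)) (cfq α n), ∑ i ∈ Finset.Ico (cfq α (m - 1)) (cfq α m),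
      (volume : Measure UnitAddCircle).real (hitBall α ε n j ∩ hitBall α ε m i) ≤
      16 * (ε / Real.log (cfq α n)) * (ε / Real.log (cfq α m)) +
        4 * (ε / Real.log (cfq α n) / cfq α n * cfq α m) := by
  obtain ⟨hr0, hr4⟩ := hitBall_radius_bounds hα hε hε4 hn
  have hqn : (1 : ℝ) ≤ cfq α n := by exact_mod_cast cfq_pos hα n
  have hqm : (1 : ℝ) ≤ cfq α m := by exact_mod_cast cfq_pos hα m
  have hqmn : (cfq α m : ℝ) ≤ cfq α n := by exact_mod_cast cfq_mono hα hmn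
  have hlm := hm.one_le_log hα
  have hr2 : 2 * (ε / Real.log (cfq α n) / cfq α n) ≤ 1 := by
    have : (4 * cfq α n : ℝ)⁻¹ ≤ 4⁻¹ := by gcongr; linarith
    linarith
  have hrr : ε / Real.log (cfq α n) / cfq α n ≤ ε / Real.log (cfq α m) / cfq α m := by
    gcongr
  have hsub : ∀ k, Finset.Ico (cfq α (k - 1)) (cfq α k) ⊆ Finset.range (cfq α k) := fun k x hx =>
    Finset.mem_range.2 (Finset.mem_Ico.1 hx).2
  refine (sum_sum_measureReal_inter_le (hn.separated hα) hr0.le hrr hr2 (hsub n) (hsub m)).trans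
    (le_of_eq ?_)
  field_simp
  ring

theorem le_measureReal_iUnion_hitBall {α ε : ℝ} (hα : Irrational α) (hε : 0 < ε) (hε4 : ε ≤ 1 / 4)
    {s : Finset ℕ} (hs : ∀ n ∈ s, IsGoodIndex α n)
    (h1 : 1 ≤ ∑ n ∈ s, ε / Real.log (cfq α n)) :
    1 / 40 ≤ (volume : Measure UnitAddCircle).real
      (⋃ p ∈ s.sigma fun n => Finset.Ico (cfq α (n - 1)) (cfq α n), hitBall α ε p.1 p.2) := by
  have hKS := sq_sum_measureReal_le (μ := (volume : Measure UnitAddCircle))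
    (s.sigma fun n => Finset.Ico (cfq α (n - 1)) (cfq α n))
    (A := fun p => hitBall α ε p.1 p.2) fun _ => Metric.isClosed_closedBall.measurableSet
  set V := ∑ n ∈ s, ε / Real.log (cfq α n) with hV
  have hw : ∀ n ∈ s, 0 < ε / Real.log (cfq α n) := fun n hn => by
    have := (hs n hn).one_le_log hα
    positivity
  have hlow : V ≤ ∑ p ∈ s.sigma fun n => Finset.Ico (cfq α (n - 1)) (cfq α n),
      (volume : Measure UnitAddCircle).real (hitBall α ε p.1 p.2) := by
    rw [Finset.sum_sigma]
    refine Finset.sum_le_sum fun n hn => ?_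
    obtain ⟨hr0, hr4⟩ := hitBall_radius_bounds hα hε hε4 (hs n hn)
    have hqn : (1 : ℝ) ≤ cfq α n := by exact_mod_cast cfq_pos hα n
    have hr2 : 2 * (ε / Real.log (cfq α n) / cfq α n) ≤ 1 := by
      have : (4 * cfq α n : ℝ)⁻¹ ≤ 4⁻¹ := by gcongr; linarith
      linarith
    have h2 : (2 : ℝ) * cfq α (n - 1) ≤ cfq α n := by
      exact_mod_cast (hs n hn).two_mul_cfq_sub_one_le
    have hle : cfq α (n - 1) ≤ cfq α n := cfq_mono hα (Nat.sub_le n 1)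
    simp only [hitBall, measureReal_closedBall _ hr0.le hr2, Finset.sum_const, Nat.card_Ico,
      nsmul_eq_mul]
    rw [Nat.cast_sub hle]
    calc ε / Real.log (cfq α n)
        = cfq α n / 2 * (2 * (ε / Real.log (cfq α n) / cfq α n)) := by field_simp
      _ ≤ _ := by gcongr; linarith
  have hratio : ∀ n ∈ s, ∑ m ∈ s with m ≤ n, ε / Real.log (cfq α n) / cfq α n * cfq α m ≤
      3 * (ε / Real.log (cfq α n)) := by
    intro n hn
    have hqn : (0 : ℝ) < cfq α n := by exact_mod_cast cfq_pos hα n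
    have hsum : ∑ m ∈ s with m ≤ n, (cfq α m : ℝ) ≤ 3 * cfq α n := by
      refine (Finset.sum_le_sum_of_subset_of_nonneg (t := Finset.range (n + 1)) ?_
        fun _ _ _ => Nat.cast_nonneg _).trans (by exact_mod_cast sum_range_succ_cfq_le hα n)
      intro m hm
      rw [Finset.mem_filter] at hm
      exact Finset.mem_range.2 (Nat.lt_succ_of_le hm.2)
    have := hw n hn
    rw [← Finset.mul_sum]
    calc _ ≤ ε / Real.log (cfq α n) / cfq α n * (3 * cfq α n) := by gcongr
      _ = _ := by field_simp
  set W := fun n m : ℕ => ∑ j ∈ Finset.Ico (cfq α (n - 1)) (cfq α n),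
    ∑ i ∈ Finset.Ico (cfq α (m - 1)) (cfq α m),
      (volume : Measure UnitAddCircle).real (hitBall α ε n j ∩ hitBall α ε m i) with hW
  have hWsymm : ∀ n m, W n m = W m n := by
    intro n m
    simp only [hW]
    rw [Finset.sum_comm]
    simp only [Set.inter_comm]
  have hWle : ∀ n ∈ s, ∀ m ∈ s, W n m ≤
      16 * (ε / Real.log (cfq α n)) * (ε / Real.log (cfq α m)) +
      (4 * (if m ≤ n then ε / Real.log (cfq α n) / cfq α n * cfq α m else 0) +
      4 * (if n ≤ m then ε / Real.log (cfq α m) / cfq α m * cfq α n else 0)) := by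
    have haux : ∀ n ∈ s, ∀ m : ℕ,
        0 ≤ if m ≤ n then ε / Real.log (cfq α n) / cfq α n * cfq α m else 0 := by
      intro n hn m
      have := hw n hn
      positivity
    intro n hn m hm
    have := haux n hn m
    have := haux m hm n
    rcases le_total m n with h | h
    · have := sum_sum_hitBall_inter_le hα hε hε4 (hs n hn) (hs m hm) h
      rw [if_pos h]
      linarith
    · have := sum_sum_hitBall_inter_le hα hε hε4 (hs m hm) (hs n hn) h
      rw [hWsymm, if_pos h]
      linarith
  have hup : ∑ p ∈ s.sigma fun n => Finset.Ico (cfq α (n - 1)) (cfq α n),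
      ∑ p' ∈ s.sigma fun n => Finset.Ico (cfq α (n - 1)) (cfq α n),
      (volume : Measure UnitAddCircle).real (hitBall α ε p.1 p.2 ∩ hitBall α ε p'.1 p'.2) ≤
      16 * V ^ 2 + 24 * V := by
    have hsplit : ∑ p ∈ s.sigma fun n => Finset.Ico (cfq α (n - 1)) (cfq α n),
        ∑ p' ∈ s.sigma fun n => Finset.Ico (cfq α (n - 1)) (cfq α n),
        (volume : Measure UnitAddCircle).real (hitBall α ε p.1 p.2 ∩ hitBall α ε p'.1 p'.2) =
        ∑ n ∈ s, ∑ m ∈ s, W n m := by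
      simp only [Finset.sum_sigma, hW]
      exact Finset.sum_congr rfl fun n _ => Finset.sum_comm
    have hhalf : ∑ n ∈ s, ∑ m ∈ s,
        (if m ≤ n then ε / Real.log (cfq α n) / cfq α n * cfq α m else 0) ≤ 3 * V := by
      rw [hV, Finset.mul_sum]
      refine Finset.sum_le_sum fun n hn => ?_
      rw [← Finset.sum_filter]
      exact hratio n hn
    have hhalf' : ∑ n ∈ s, ∑ m ∈ s,
        (if n ≤ m then ε / Real.log (cfq α m) / cfq α m * cfq α n else 0) ≤ 3 * V := by
      rwa [Finset.sum_comm]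
    have hprod : ∑ n ∈ s, ∑ m ∈ s,
        16 * (ε / Real.log (cfq α n)) * (ε / Real.log (cfq α m)) = 16 * V ^ 2 := by
      rw [sq, hV, Finset.sum_mul_sum, Finset.mul_sum]
      refine Finset.sum_congr rfl fun n _ => ?_
      rw [Finset.mul_sum]
      exact Finset.sum_congr rfl fun m _ => by ring
    rw [hsplit]
    refine (Finset.sum_le_sum fun n hn => Finset.sum_le_sum fun m hm => hWle n hn m hm).trans ?_
    simp only [Finset.sum_add_distrib, ← Finset.mul_sum (a := (4 : ℝ))]
    rw [hprod]
    linarith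
  have hU : 0 ≤ (volume : Measure UnitAddCircle).real
    (⋃ p ∈ s.sigma fun n => Finset.Ico (cfq α (n - 1)) (cfq α n), hitBall α ε p.1 p.2) :=
    measureReal_nonneg
  have h2 : V ^ 2 ≤ (volume : Measure UnitAddCircle).real
      (⋃ p ∈ s.sigma fun n => Finset.Ico (cfq α (n - 1)) (cfq α n), hitBall α ε p.1 p.2) *
      (40 * V ^ 2) := by
    calc V ^ 2 ≤ _ := by gcongr
      _ ≤ _ := hKS
      _ ≤ _ := by
        gcongr
        nlinarith
  have h3 : 0 < V ^ 2 := by positivity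
  by_contra! hlt
  nlinarith

theorem exists_finset_isGoodIndex {α ε : ℝ} (hε : 0 < ε)
    (hdiv : (∑' n : ℕ, if 2 ≤ n ∧ 2 ≤ cfa α n ∧ 2 ≤ cfa α (n + 1)
        then ENNReal.ofReal (1 / Real.log ((cfq α n : ℝ))) else 0) = ⊤) (N : ℕ) :
    ∃ s : Finset ℕ, (∀ n ∈ s, IsGoodIndex α n ∧ N ≤ n) ∧
      1 ≤ ∑ n ∈ s, ε / Real.log (cfq α n) := by
  classical
  set u : ℕ → ℝ := fun n => if IsGoodIndex α n then 1 / Real.log (cfq α n) else 0 with hu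
  have hu0 : ∀ n, 0 ≤ u n := by
    intro n
    have := Real.log_natCast_nonneg (cfq α n)
    simp only [hu]
    positivity
  have hns : ¬ Summable u := by
    intro hsum
    apply hsum.tsum_ofReal_ne_top
    rw [← hdiv]
    refine tsum_congr fun n => ?_
    by_cases h : IsGoodIndex α n
    · simp only [hu, if_pos h]
      exact (if_pos h).symm
    · simp only [hu, if_neg h, ENNReal.ofReal_zero]
      exact (if_neg h).symm
  have htend := (not_summable_iff_tendsto_nat_atTop_of_nonneg hu0).1 hns
  obtain ⟨K, hNK, hK⟩ := ((eventually_ge_atTop N).and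
    (htend.eventually_ge_atTop (∑ n ∈ Finset.range N, u n + 1 / ε))).exists
  refine ⟨(Finset.Ico N K).filter (IsGoodIndex α), fun n hn => ?_, ?_⟩
  · rw [Finset.mem_filter, Finset.mem_Ico] at hn
    exact ⟨hn.2, hn.1.1⟩
  · have h1 : 1 / ε ≤ ∑ n ∈ Finset.Ico N K, u n := by
      rw [Finset.sum_Ico_eq_sub _ hNK]
      linarith
    rw [Finset.sum_filter]
    calc (1 : ℝ) = ε * (1 / ε) := by field_simp
      _ ≤ ε * ∑ n ∈ Finset.Ico N K, u n := by gcongr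
      _ = _ := by
        rw [Finset.mul_sum]
        refine Finset.sum_congr rfl fun n _ => ?_
        simp only [hu]
        split_ifs <;> ring

/-- The points at which time `j` beats `M` times the sum over the earlier times. -/
def beatSet (α M : ℝ) (j : ℕ) : Set UnitAddCircle :=
  {x | M * ∑ i ∈ Finset.range j, ‖x + i • (α : UnitAddCircle)‖⁻¹ <
    ‖x + j • (α : UnitAddCircle)‖⁻¹}

theorem measurableSet_beatSet (α M : ℝ) (j : ℕ) : MeasurableSet (beatSet α M j) := by
  have h : ∀ i : ℕ, Measurable fun x : UnitAddCircle => ‖x + i • (α : UnitAddCircle)‖⁻¹ :=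
    fun i => (measurable_id.add_const _).norm.inv
  exact measurableSet_lt ((Finset.measurable_fun_sum _ fun i _ => h i).const_mul M) (h j)

theorem mem_beatSet_of_mem_hitBall {α ε M : ℝ} (hα : Irrational α) (hε : 0 < ε)
    (hε4 : ε ≤ 1 / 4) (hM : 0 < M) (hMε : 30 * M * ε < 1) {n j : ℕ} (hn : IsGoodIndex α n)
    (hj : j < cfq α n) {x : UnitAddCircle} (hx : x ∈ hitBall α ε n j)
    (hne : x + j • (α : UnitAddCircle) ≠ 0) : x ∈ beatSet α M j := by
  obtain ⟨hr0, hr4⟩ := hitBall_radius_bounds hα hε hε4 hn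
  have hx' : ‖x + j • (α : UnitAddCircle)‖ ≤ ε / Real.log (cfq α n) / cfq α n := by
    rwa [hitBall, Metric.mem_closedBall, dist_eq_norm, sub_neg_eq_add] at hx
  have hq : (0 : ℝ) < cfq α n := by exact_mod_cast cfq_pos hα n
  have hl := hn.one_le_log hα
  have hsum := sum_inv_norm_le (three_le_cfq hα hn.1 hn.2.1) (hn.separated hα) hj (hx'.trans hr4)
  have hpos : 0 < ‖x + j • (α : UnitAddCircle)‖ := norm_pos_iff.2 hne
  calc M * ∑ i ∈ Finset.range j, ‖x + i • (α : UnitAddCircle)‖⁻¹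
      ≤ M * (30 * (cfq α n * Real.log (cfq α n))) := by gcongr
    _ = 30 * M * ε * (ε / Real.log (cfq α n) / cfq α n)⁻¹ := by field_simp
    _ < 1 * (ε / Real.log (cfq α n) / cfq α n)⁻¹ := by gcongr
    _ ≤ ‖x + j • (α : UnitAddCircle)‖⁻¹ := by rw [one_mul]; gcongr

theorem volume_setOf_exists_add_nsmul_eq_zero (a : UnitAddCircle) :
    volume {x : UnitAddCircle | ∃ j : ℕ, x + j • a = 0} = 0 := by
  rw [Set.ofPred_exists]
  refine measure_iUnion_null fun j => ?_
  refine measure_mono_null (t := Metric.closedBall (-(j • a)) 0) ?_ ?_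
  · intro x hx
    rw [Metric.closedBall_zero]
    exact eq_neg_of_add_eq_zero_left hx
  · rw [AddCircle.volume_closedBall, mul_zero, min_eq_right zero_le_one, ENNReal.ofReal_zero]

theorem le_volume_iUnion_beatSet {α M : ℝ} (hα : Irrational α)
    (hdiv : (∑' n : ℕ, if 2 ≤ n ∧ 2 ≤ cfa α n ∧ 2 ≤ cfa α (n + 1)
        then ENNReal.ofReal (1 / Real.log ((cfq α n : ℝ))) else 0) = ⊤)
    (hM : 0 < M) (N : ℕ) :
    ENNReal.ofReal (1 / 40) ≤ volume (⋃ j ≥ N, beatSet α M j) := by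
  set ε : ℝ := 1 / (30 * M + 4) with hεdef
  have hε : 0 < ε := by positivity
  have hε4 : ε ≤ 1 / 4 := by
    rw [hεdef]
    gcongr
    linarith
  have hMε : 30 * M * ε < 1 := by
    rw [hεdef, mul_one_div, div_lt_one (by positivity)]
    linarith
  obtain ⟨s, hs, hs1⟩ := exists_finset_isGoodIndex hε hdiv (N + 1)
  have hvol := le_measureReal_iUnion_hitBall hα hε hε4 (fun n hn => (hs n hn).1) hs1
  calc ENNReal.ofReal (1 / 40)
      ≤ volume (⋃ p ∈ s.sigma fun n => Finset.Ico (cfq α (n - 1)) (cfq α n),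
          hitBall α ε p.1 p.2) := ENNReal.ofReal_le_of_le_toReal hvol
    _ ≤ volume ((⋃ j ≥ N, beatSet α M j) ∪
          {x : UnitAddCircle | ∃ j : ℕ, x + j • (α : UnitAddCircle) = 0}) := by
        refine measure_mono fun x hx => ?_
        simp only [Set.mem_iUnion, Finset.mem_sigma, Finset.mem_Ico] at hx
        obtain ⟨⟨n, j⟩, ⟨hns, hjl, hju⟩, hxb⟩ := hx
        by_cases h0 : x + j • (α : UnitAddCircle) = 0
        · exact Or.inr ⟨j, h0⟩
        · have hNj : N ≤ j := by
            have h1 := (hs n hns).2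
            have h2 := le_cfq hα (n - 1)
            dsimp only at hjl
            omega
          exact Or.inl (Set.mem_biUnion (show j ∈ {j | j ≥ N} from hNj)
            (mem_beatSet_of_mem_hitBall hα hε hε4 hM hMε (hs n hns).1 hju hxb h0))
    _ ≤ volume (⋃ j ≥ N, beatSet α M j) := by
        refine (measure_union_le _ _).trans ?_
        rw [volume_setOf_exists_add_nsmul_eq_zero, add_zero]

theorem setOf_frequently_beatSet (α M : ℝ) :
    {x | ∃ᶠ j in atTop, x ∈ beatSet α M j} = ⋂ N, ⋃ j ≥ N, beatSet α M j := by
  ext x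
  simp [frequently_atTop]

theorem add_mem_beatSet {α M : ℝ} (hM : 0 < M) {x : UnitAddCircle} {j : ℕ}
    (h : x ∈ beatSet α M (j + 1)) : (α : UnitAddCircle) + x ∈ beatSet α M j := by
  have hshift : ∀ i : ℕ, (α : UnitAddCircle) + x + i • (α : UnitAddCircle) =
      x + (i + 1) • (α : UnitAddCircle) := fun i => by rw [succ_nsmul]; abel
  simp only [beatSet, Set.mem_ofPred_eq, hshift] at h ⊢
  refine lt_of_le_of_lt ?_ h
  rw [Finset.sum_range_succ']
  gcongr
  exact le_add_of_nonneg_right (inv_nonneg.2 (norm_nonneg _))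

theorem ergodic_add_left_of_irrational {α : ℝ} (hα : Irrational α) :
    Ergodic ((α : UnitAddCircle) + ·) := by
  have : Fact ((0 : ℝ) < 1) := ⟨one_pos⟩
  rw [AddCircle.ergodic_add_left, addOrderOf_eq_zero_iff,
    AddCircle.not_isOfFinAddOrder_iff_forall_rat_ne_div]
  exact fun r hr => hα ⟨r, by simpa using hr⟩

theorem ae_frequently_beatSet {α M : ℝ} (hα : Irrational α)
    (hdiv : (∑' n : ℕ, if 2 ≤ n ∧ 2 ≤ cfa α n ∧ 2 ≤ cfa α (n + 1)
        then ENNReal.ofReal (1 / Real.log ((cfq α n : ℝ))) else 0) = ⊤) (hM : 0 < M) :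
    ∀ᵐ x : UnitAddCircle, ∃ᶠ j in atTop, x ∈ beatSet α M j := by
  have hmeas : ∀ N, MeasurableSet (⋃ j ≥ N, beatSet α M j) := fun N =>
    MeasurableSet.iUnion fun j => MeasurableSet.iUnion fun _ => measurableSet_beatSet α M j
  set E := {x | ∃ᶠ j in atTop, x ∈ beatSet α M j} with hE
  have hEeq : E = ⋂ N, ⋃ j ≥ N, beatSet α M j := setOf_frequently_beatSet α M
  have hEm : MeasurableSet E := hEeq ▸ MeasurableSet.iInter hmeas
  have hanti : Antitone fun N => ⋃ j ≥ N, beatSet α M j := fun N N' h =>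
    Set.biUnion_subset_biUnion_left fun j hj => h.trans hj
  have hpos : volume E ≠ 0 := by
    rw [hEeq, hanti.measure_iInter (fun N => (hmeas N).nullMeasurableSet) ⟨0, measure_ne_top _ _⟩]
    have hle := le_iInf fun N => le_volume_iUnion_beatSet hα hdiv hM N
    exact (lt_of_lt_of_le (ENNReal.ofReal_pos.2 (by norm_num)) hle).ne'
  have hsub : E ⊆ ((α : UnitAddCircle) + ·) ⁻¹' E := by
    intro x hx
    refine frequently_atTop.2 fun N => ?_
    obtain ⟨j, hj, hxj⟩ := frequently_atTop.1 hx (N + 1)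
    obtain ⟨j, rfl⟩ := Nat.exists_eq_add_of_le' (le_of_add_le_right hj)
    exact ⟨j, by omega, add_mem_beatSet hM hxj⟩
  rcases (ergodic_add_left_of_irrational hα).ae_empty_or_univ_of_ae_le_preimage
    hEm.nullMeasurableSet hsub.eventuallyLE with h | h
  · exact absurd (by rw [measure_congr h, measure_empty]) hpos
  · exact eventuallyEq_univ.1 h

/-- Let `α` be irrational with `aₙ ≥ 2` for infinitely many
`n`, and such that `Σ_{n ≥ 2, aₙ ≥ 2, a_{n+1} ≥ 2} 1/log qₙ = ∞`.  Then for
Haar-almost every `x ∈ T` one has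
`limsup_j ‖x + jα‖⁻¹ / Σ_{i<j} ‖x + iα‖⁻¹ = +∞`, i.e. for every `M > 0`,
frequently in `j`, `‖x + jα‖⁻¹ > M Σ_{i<j} ‖x + iα‖⁻¹` (in particular such a
`j` exists for every `M > 0`). -/
theorem stmt_16 (α : ℝ) (hα : Irrational α)
    (ha2 : ∀ N : ℕ, ∃ n ≥ N, 2 ≤ cfa α n)
    (hdiv : (∑' n : ℕ, if 2 ≤ n ∧ 2 ≤ cfa α n ∧ 2 ≤ cfa α (n + 1)
        then ENNReal.ofReal (1 / Real.log ((cfq α n : ℝ))) else 0) = ⊤) :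
    ∀ᵐ x : UnitAddCircle, ∀ M : ℝ, 0 < M → ∃ᶠ j in atTop,
      M * ∑ i ∈ Finset.range j, ‖x + i • (α : UnitAddCircle)‖⁻¹ <
        ‖x + j • (α : UnitAddCircle)‖⁻¹ := by
  have hnat : ∀ᵐ x : UnitAddCircle, ∀ k : ℕ, ∃ᶠ j in atTop, x ∈ beatSet α (k + 1) j :=
    ae_all_iff.2 fun k => ae_frequently_beatSet hα hdiv (by positivity)
  filter_upwards [hnat] with x hx M _
  obtain ⟨k, hk⟩ := exists_nat_ge M
  refine (hx k).mono fun j hj => lt_of_le_of_lt ?_ hj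
  gcongr
  linarith
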